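/- Let B be a compact basis in M_{I,J}(ℝ) and let π ∈ Π(P,Q) and M ∈ B. Then Tr(Mᵀ σ_π) = sup over all π̃ ∈ Π(P,Q) of Tr(Mᵀ σ_{π̃}) if and only if there exists a proper lower semicontinuous convex function u : ℝ^I → ℝ ∪ {+∞} such that for π-almost every (x,y), My belongs to the subdifferential of u at x, i.e. u(z) ≥ u(x) + (My)·(z − x) for all z ∈ ℝ^I. -/

import Mathlib

open MeasureTheory Matrix

/-- The set of couplings of `P` and `Q`. -/
def couplings {I J : ℕ} (P : Measure (Fin I → ℝ)) (Q : Measure (Fin J → ℝ)) :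
    Set (Measure ((Fin I → ℝ) × (Fin J → ℝ))) :=
  {π | IsProbabilityMeasure π ∧ π.map Prod.fst = P ∧ π.map Prod.snd = Q}

/-- The cross-covariance matrix of a coupling. -/
noncomputable def crossCov {I J : ℕ} (π : Measure ((Fin I → ℝ) × (Fin J → ℝ))) :
    Matrix (Fin I) (Fin J) ℝ :=
  Matrix.of fun i j => ∫ p, p.1 i * p.2 j ∂π

/-- Convexity for extended-real-valued functions on `ℝ^I`. -/
def ERealConvexOn {n : ℕ} (u : (Fin n → ℝ) → EReal) : Prop :=
  ∀ x y : Fin n → ℝ, ∀ a b : ℝ, 0 ≤ a → 0 ≤ b → a + b = 1 →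
    u (a • x + b • y) ≤ (a : EReal) * u x + (b : EReal) * u y

theorem swap_improves {X Y : Type*} [MetricSpace X] [MetricSpace Y]
    [MeasurableSpace X] [MeasurableSpace Y] [BorelSpace X] [BorelSpace Y]
    [SecondCountableTopology X] [SecondCountableTopology Y]
    (π : Measure (X × Y)) [IsProbabilityMeasure π] (c : X × Y → ℝ) (hc : Continuous c)
    (hint : ∀ π' : Measure (X × Y), IsProbabilityMeasure π' → π'.map Prod.fst = π.map Prod.fst →
      π'.map Prod.snd = π.map Prod.snd → Integrable c π')
    {ι : Type*} [Fintype ι] [Nonempty ι] (σ : Equiv.Perm ι) (p : ι → X × Y)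
    (hp : ∀ i, p i ∈ π.support)
    (hlt : ∑ i, c (p i) < ∑ i, c ((p (σ i)).1, (p i).2)) :
    ∃ π' : Measure (X × Y), IsProbabilityMeasure π' ∧ π'.map Prod.fst = π.map Prod.fst ∧
      π'.map Prod.snd = π.map Prod.snd ∧ ∫ q, c q ∂π < ∫ q, c q ∂π' := by
  classical
  have hN : (0:ℝ) < Fintype.card ι := by exact_mod_cast Fintype.card_pos
  obtain ⟨δ, hδ, hδ2⟩ : ∃ δ : ℝ, 0 < δ ∧
      ∑ i, (c (p i) + δ) < ∑ i, (c ((p (σ i)).1, (p i).2) - δ) := by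
    refine ⟨(∑ i, c ((p (σ i)).1, (p i).2) - ∑ i, c (p i)) / (3 * Fintype.card ι), ?_, ?_⟩
    · apply div_pos <;> linarith
    · rw [Finset.sum_add_distrib, Finset.sum_sub_distrib, Finset.sum_const, Finset.card_univ,
        nsmul_eq_mul]
      have : (Fintype.card ι : ℝ) * ((∑ i, c ((p (σ i)).1, (p i).2) - ∑ i, c (p i)) /
        (3 * Fintype.card ι)) = (∑ i, c ((p (σ i)).1, (p i).2) - ∑ i, c (p i)) / 3 := by
        field_simp
      rw [this]; linarith
  -- common radius
  have key : ∀ q : X × Y, ∀ᶠ r in nhdsWithin (0:ℝ) (Set.Ioi 0),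
      ∀ q' ∈ Metric.ball q r, |c q' - c q| ≤ δ := by
    intro q
    obtain ⟨r, hr, h⟩ := Metric.continuous_iff.1 hc q δ hδ
    filter_upwards [Ioo_mem_nhdsGT hr] with s hs q' hq'
    have := h q' (lt_trans (Metric.mem_ball.1 hq') hs.2)
    rw [Real.dist_eq] at this
    exact this.le
  obtain ⟨r, ⟨hr1, hr2⟩, hr⟩ := (((Filter.eventually_all.2 fun i => key (p i)).and
    (Filter.eventually_all.2 fun i => key ((p (σ i)).1, (p i).2))).and
      self_mem_nhdsWithin).exists
  have hr : 0 < r := hr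
  set W : ι → Set (X × Y) := fun i => Metric.ball (p i) r with hW
  have hWm : ∀ i, MeasurableSet (W i) := fun i => Metric.isOpen_ball.measurableSet
  have hWpos : ∀ i, 0 < π (W i) := fun i =>
    (Measure.mem_support_iff_forall _).1 (hp i) _ (Metric.ball_mem_nhds _ hr)
  set l : ι → Measure (X × Y) := fun i => ProbabilityTheory.cond π (W i) with hl
  have hlp : ∀ i, IsProbabilityMeasure (l i) := fun i =>
    ProbabilityTheory.cond_isProbabilityMeasure (hWpos i).ne'
  have hl1 : ∀ i, IsProbabilityMeasure ((l i).map Prod.fst) := fun i =>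
    Measure.isProbabilityMeasure_map measurable_fst.aemeasurable
  have hl2 : ∀ i, IsProbabilityMeasure ((l i).map Prod.snd) := fun i =>
    Measure.isProbabilityMeasure_map measurable_snd.aemeasurable
  obtain ⟨i0, hi0⟩ := Finite.exists_min (fun i => π (W i))
  set N : ENNReal := (Fintype.card ι : ENNReal) with hNdef
  have hN0 : N ≠ 0 := by simp [hNdef]
  have hNt : N ≠ ⊤ := by simp [hNdef]
  set ε : ENNReal := π (W i0) / N with hε
  have hε0 : ε ≠ 0 := by
    rw [hε]; exact (ENNReal.div_pos (hWpos i0).ne' hNt).ne'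
  have hεt : ε ≠ ⊤ := ENNReal.div_ne_top (measure_ne_top _ _) hN0
  have hεr : 0 < ε.toReal := ENNReal.toReal_pos hε0 hεt
  set ν : Measure (X × Y) := ε • ∑ i, l i with hν
  set ν' : Measure (X × Y) :=
    ε • ∑ i, ((l (σ i)).map Prod.fst).prod ((l i).map Prod.snd) with hν'
  have hνle : ν ≤ π := by
    refine Measure.le_iff.2 fun s hs => ?_
    have : ∀ i, ε * l i s ≤ N⁻¹ * π s := by
      intro i
      rw [hl]
      simp only
      rw [ProbabilityTheory.cond_apply (hWm i), hε, div_eq_mul_inv, mul_comm (π (W i0)), mul_assoc]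
      gcongr
      rw [← mul_assoc]
      calc π (W i0) * (π (W i))⁻¹ * π (W i ∩ s) ≤ 1 * π s := by
            gcongr
            · rw [← div_eq_mul_inv]
              exact ENNReal.div_le_of_le_mul (by simpa using hi0 i)
            · exact Set.inter_subset_right
        _ = π s := one_mul _
    rw [hν, Measure.smul_apply, Measure.finsetSum_apply, smul_eq_mul, Finset.mul_sum]
    calc ∑ i, ε * l i s ≤ ∑ i : ι, N⁻¹ * π s := Finset.sum_le_sum fun i _ => this i
      _ = π s := by
        rw [Finset.sum_const, Finset.card_univ, nsmul_eq_mul, ← mul_assoc,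
          ENNReal.mul_inv_cancel hN0 hNt, one_mul]
  have hνfin : IsFiniteMeasure ν := isFiniteMeasure_of_le π hνle
  have hsplit : π - ν + ν = π := Measure.sub_add_cancel_of_le hνle
  have m1 : ν'.map Prod.fst = ν.map Prod.fst := by
    rw [hν, hν', Measure.map_smul, Measure.map_smul,
      ← Measure.mapₗ_apply_of_measurable measurable_fst,
      ← Measure.mapₗ_apply_of_measurable measurable_fst, map_sum, map_sum]
    congr 1
    rw [← Equiv.sum_comp σ (fun i => Measure.mapₗ Prod.fst (l i))]
    refine Finset.sum_congr rfl fun i _ => ?_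
    rw [Measure.mapₗ_apply_of_measurable measurable_fst,
      Measure.mapₗ_apply_of_measurable measurable_fst, Measure.map_fst_prod]
    simp
  have m2 : ν'.map Prod.snd = ν.map Prod.snd := by
    rw [hν, hν', Measure.map_smul, Measure.map_smul,
      ← Measure.mapₗ_apply_of_measurable measurable_snd,
      ← Measure.mapₗ_apply_of_measurable measurable_snd, map_sum, map_sum]
    congr 1
    refine Finset.sum_congr rfl fun i _ => ?_
    rw [Measure.mapₗ_apply_of_measurable measurable_snd,
      Measure.mapₗ_apply_of_measurable measurable_snd, Measure.map_snd_prod]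
    simp
  set π' := π - ν + ν' with hπ'
  have k1 : π'.map Prod.fst = π.map Prod.fst := by
    rw [hπ', Measure.map_add _ _ measurable_fst, m1, ← Measure.map_add _ _ measurable_fst, hsplit]
  have k2 : π'.map Prod.snd = π.map Prod.snd := by
    rw [hπ', Measure.map_add _ _ measurable_snd, m2, ← Measure.map_add _ _ measurable_snd, hsplit]
  have k0 : IsProbabilityMeasure π' := by
    have : IsProbabilityMeasure (π'.map Prod.fst) := by
      rw [k1]; exact Measure.isProbabilityMeasure_map measurable_fst.aemeasurable
    constructor
    have h := this.measure_univ
    rwa [Measure.map_apply measurable_fst MeasurableSet.univ, Set.preimage_univ] at h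
  refine ⟨π', k0, k1, k2, ?_⟩
  have I0 : Integrable c π := hint π inferInstance rfl rfl
  have I1 : Integrable c π' := hint π' k0 k1 k2
  have Isub : Integrable c (π - ν) := I0.mono_measure Measure.sub_le
  have Iν : Integrable c ν := I0.mono_measure hνle
  have Iν' : Integrable c ν' := I1.mono_measure (by
    rw [hπ']; exact Measure.le_add_left le_rfl)
  have Il : ∀ i, Integrable c (l i) := by
    have h := (integrable_smul_measure hε0 hεt).1 Iν
    exact fun i => (integrable_finsetSum_measure.1 h) i (Finset.mem_univ i)
  have Il' : ∀ i, Integrable c (((l (σ i)).map Prod.fst).prod ((l i).map Prod.snd)) := by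
    have h := (integrable_smul_measure hε0 hεt).1 Iν'
    exact fun i => (integrable_finsetSum_measure.1 h) i (Finset.mem_univ i)
  have e1 : ∫ q, c q ∂π = ∫ q, c q ∂(π - ν) + ∫ q, c q ∂ν := by
    rw [← integral_add_measure Isub Iν, hsplit]
  have e2 : ∫ q, c q ∂π' = ∫ q, c q ∂(π - ν) + ∫ q, c q ∂ν' := by
    rw [← integral_add_measure Isub Iν']
  rw [e1, e2]
  have aeW : ∀ i, ∀ᵐ q ∂(l i), q ∈ W i := fun i => ProbabilityTheory.ae_cond_mem (hWm i)
  have b1 : ∫ q, c q ∂ν ≤ ε.toReal * ∑ i, (c (p i) + δ) := by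
    rw [hν, integral_smul_measure, integral_finsetSum_measure (fun i _ => Il i), smul_eq_mul]
    gcongr with i
    calc ∫ q, c q ∂(l i) ≤ ∫ q, (c (p i) + δ) ∂(l i) := by
          refine integral_mono_ae (Il i) (integrable_const _) ?_
          filter_upwards [aeW i] with q hq
          have := abs_le.1 (hr1 i q hq)
          linarith
      _ = _ := by simp
  have b2 : ε.toReal * ∑ i, (c ((p (σ i)).1, (p i).2) - δ) ≤ ∫ q, c q ∂ν' := by
    rw [hν', integral_smul_measure, integral_finsetSum_measure (fun i _ => Il' i), smul_eq_mul]
    gcongr with i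
    calc c ((p (σ i)).1, (p i).2) - δ =
          ∫ q, (c ((p (σ i)).1, (p i).2) - δ) ∂(((l (σ i)).map Prod.fst).prod
            ((l i).map Prod.snd)) := by simp
      _ ≤ _ := by
          refine integral_mono_ae (integrable_const _) (Il' i) ?_
          have a1 : ∀ᵐ x ∂((l (σ i)).map Prod.fst), x ∈ Metric.ball (p (σ i)).1 r := by
            refine (ae_map_iff (p := fun x => x ∈ Metric.ball (p (σ i)).1 r)
              measurable_fst.aemeasurable Metric.isOpen_ball.measurableSet).2 ?_
            filter_upwards [aeW (σ i)] with q hq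
            rw [hW, Metric.mem_ball, Prod.dist_eq] at hq
            exact lt_of_le_of_lt (le_max_left _ _) hq
          have a2 : ∀ᵐ x ∂((l i).map Prod.snd), x ∈ Metric.ball (p i).2 r := by
            refine (ae_map_iff (p := fun x => x ∈ Metric.ball (p i).2 r)
              measurable_snd.aemeasurable Metric.isOpen_ball.measurableSet).2 ?_
            filter_upwards [aeW i] with q hq
            rw [hW, Metric.mem_ball, Prod.dist_eq] at hq
            exact lt_of_le_of_lt (le_max_right _ _) hq
          filter_upwards [Measure.quasiMeasurePreserving_fst.ae a1,
            Measure.quasiMeasurePreserving_snd.ae a2] with q h1 h2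
          have h3 : q ∈ Metric.ball ((p (σ i)).1, (p i).2) r := by
            rw [Metric.mem_ball, Prod.dist_eq]
            exact max_lt h1 h2
          have := abs_le.1 (hr2 i q h3)
          linarith
  have : ε.toReal * ∑ i, (c (p i) + δ) < ε.toReal * ∑ i, (c ((p (σ i)).1, (p i).2) - δ) :=
    mul_lt_mul_of_pos_left hδ2 hεr
  linarith

theorem rockafellar {I J : ℕ} (M : Matrix (Fin I) (Fin J) ℝ)
    (Γ : Set ((Fin I → ℝ) × (Fin J → ℝ))) (hne : Γ.Nonempty)
    (hcyc : ∀ (n : ℕ) (p : Fin (n + 1) → (Fin I → ℝ) × (Fin J → ℝ)), (∀ i, p i ∈ Γ) →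
      ∑ i, M.mulVec (p i).2 ⬝ᵥ (p (finRotate (n + 1) i)).1 ≤ ∑ i, M.mulVec (p i).2 ⬝ᵥ (p i).1) :
    ∃ u : (Fin I → ℝ) → EReal,
        (∃ x, u x ≠ ⊤) ∧ (∀ x, u x ≠ ⊥) ∧ LowerSemicontinuous u ∧ ERealConvexOn u ∧
          ∀ p ∈ Γ, ∀ z : Fin I → ℝ,
            u p.1 + ((M.mulVec p.2 ⬝ᵥ (z - p.1) : ℝ) : EReal) ≤ u z := by
  classical
  obtain ⟨p0, hp0⟩ := hne
  let T := ℕ × {p : ℕ → (Fin I → ℝ) × (Fin J → ℝ) // (∀ k, p k ∈ Γ) ∧ p 0 = p0}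
  let A : T → (Fin I → ℝ) → ℝ := fun t z =>
    ∑ k ∈ Finset.range t.1, M.mulVec (t.2.1 k).2 ⬝ᵥ ((t.2.1 (k + 1)).1 - (t.2.1 k).1) +
      M.mulVec (t.2.1 t.1).2 ⬝ᵥ (z - (t.2.1 t.1).1)
  let t0 : T := (0, ⟨fun _ => p0, fun _ => hp0, rfl⟩)
  have hAc : ∀ t, Continuous (A t) := by
    intro t
    simp only [A, dotProduct]
    fun_prop
  refine ⟨fun z => ⨆ t, ((A t z : ℝ) : EReal), ⟨p0.1, ?_⟩, ?_, ?_, ?_, ?_⟩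
  · have : (⨆ t, ((A t p0.1 : ℝ) : EReal)) ≤ 0 := by
      refine iSup_le fun t => ?_
      obtain ⟨n, p, hp, hpz⟩ := t
      have h := hcyc n (fun i => p i) (fun i => hp _)
      rw [Fin.sum_univ_castSucc, Fin.sum_univ_castSucc, finRotate_last] at h
      have e : ∀ i : Fin n, ((finRotate (n + 1) i.castSucc : Fin (n + 1)) : ℕ) = (i : ℕ) + 1 := by
        intro i
        have := finRotate_of_lt i.2
        have h2 : i.castSucc = ⟨(i : ℕ), by omega⟩ := rfl
        rw [h2, this]
      simp only [e, Fin.val_castSucc, Fin.val_last, Fin.val_zero, hpz] at h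
      rw [Fin.sum_univ_eq_sum_range (fun k => M.mulVec (p k).2 ⬝ᵥ (p (k + 1)).1) n,
        Fin.sum_univ_eq_sum_range (fun k => M.mulVec (p k).2 ⬝ᵥ (p k).1) n] at h
      have : A (n, ⟨p, hp, hpz⟩) p0.1 ≤ 0 := by
        simp only [A, dotProduct_sub, Finset.sum_sub_distrib]
        linarith
      exact_mod_cast this
    intro h
    simp only at h
    rw [h] at this
    simp at this
  · intro x h
    have : ((A t0 x : ℝ) : EReal) ≤ ⨆ t, ((A t x : ℝ) : EReal) := le_iSup (fun t => ((A t x : ℝ) : EReal)) t0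
    simp only at h
    rw [h] at this
    simp at this
  · exact lowerSemicontinuous_iSup fun t =>
      (continuous_coe_real_ereal.comp (hAc t)).lowerSemicontinuous
  · intro x y a b ha hb hab
    refine iSup_le fun t => ?_
    have e : A t (a • x + b • y) = a * A t x + b * A t y := by
      simp only [A, dotProduct_sub, dotProduct_add, dotProduct_smul, smul_eq_mul]
      have hb' : b = 1 - a := by linarith
      subst hb'
      ring
    rw [e]
    push_cast
    refine add_le_add ?_ ?_
    · exact mul_le_mul_of_nonneg_left (le_iSup (fun t => ((A t x : ℝ) : EReal)) t)
        (by exact_mod_cast ha)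
    · exact mul_le_mul_of_nonneg_left (le_iSup (fun t => ((A t y : ℝ) : EReal)) t)
        (by exact_mod_cast hb)
  · intro q hq z
    simp only
    rw [← EReal.le_sub_iff_add_le (Or.inl (EReal.coe_ne_bot _)) (Or.inl (EReal.coe_ne_top _))]
    refine iSup_le fun t => ?_
    rw [EReal.le_sub_iff_add_le (Or.inl (EReal.coe_ne_bot _)) (Or.inl (EReal.coe_ne_top _))]
    obtain ⟨n, p, hp, hpz⟩ := t
    let t' : T := (n + 1, ⟨fun k => if k ≤ n then p k else q, fun k => by
      by_cases h : k ≤ n <;> simp [h, hp, hq], by simp [hpz]⟩)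
    refine le_trans (le_of_eq ?_) (le_iSup (fun t => ((A t z : ℝ) : EReal)) t')
    rw [← EReal.coe_add]
    congr 1
    simp only [A, t']
    rw [Finset.sum_range_succ]
    simp only [le_refl, if_true, Nat.succ_le_iff, lt_irrefl, if_false]
    congr 1
    congr 1
    refine Finset.sum_congr rfl fun k hk => ?_
    have hk := Finset.mem_range.1 hk
    rw [if_pos hk, if_pos hk.le]

section integ
variable {I J : ℕ} {P : Measure (Fin I → ℝ)} {Q : Measure (Fin J → ℝ)}

theorem integ_aux (hP : Integrable (fun x => ‖x‖ ^ 2) P) (hQ : Integrable (fun y => ‖y‖ ^ 2) Q)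
    {π : Measure ((Fin I → ℝ) × (Fin J → ℝ))} (hπ : π ∈ couplings P Q)
    (h : (Fin I → ℝ) × (Fin J → ℝ) → ℝ) (hc : Continuous h)
    (hb : ∀ p, |h p| ≤ 1 + ‖p.1‖ ^ 2 + ‖p.2‖ ^ 2) :
    Integrable h π ∧ |∫ p, h p ∂π| ≤ 1 + ∫ x, ‖x‖ ^ 2 ∂P + ∫ y, ‖y‖ ^ 2 ∂Q := by
  obtain ⟨h0, h1, h2⟩ := hπ
  subst h1 h2
  have i1 : Integrable (fun p : (Fin I → ℝ) × (Fin J → ℝ) => ‖p.1‖ ^ 2) π :=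
    hP.comp_measurable measurable_fst
  have i2 : Integrable (fun p : (Fin I → ℝ) × (Fin J → ℝ) => ‖p.2‖ ^ 2) π :=
    hQ.comp_measurable measurable_snd
  have i3 := ((integrable_const (1:ℝ)).add i1).add i2
  have i4 : Integrable h π := i3.mono' hc.aestronglyMeasurable (Filter.Eventually.of_forall hb)
  refine ⟨i4, ?_⟩
  rw [integral_map measurable_fst.aemeasurable hP.1, integral_map measurable_snd.aemeasurable hQ.1]
  calc |∫ p, h p ∂π| ≤ ∫ p, |h p| ∂π := abs_integral_le_integral_abs
    _ ≤ ∫ p, (1 + ‖p.1‖ ^ 2 + ‖p.2‖ ^ 2) ∂π := integral_mono i4.abs i3 hb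
    _ = _ := by
      rw [integral_add (by exact (integrable_const (1:ℝ)).add i1) i2,
        integral_add (integrable_const (1:ℝ)) i1]
      simp

theorem integ_mul (hP : Integrable (fun x => ‖x‖ ^ 2) P) (hQ : Integrable (fun y => ‖y‖ ^ 2) Q)
    {π : Measure ((Fin I → ℝ) × (Fin J → ℝ))} (hπ : π ∈ couplings P Q) (i : Fin I) (j : Fin J) :
    Integrable (fun p => p.1 i * p.2 j) π ∧
      |∫ p, p.1 i * p.2 j ∂π| ≤ 1 + ∫ x, ‖x‖ ^ 2 ∂P + ∫ y, ‖y‖ ^ 2 ∂Q := by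
  refine integ_aux hP hQ hπ _ (by fun_prop) fun p => ?_
  have h1 : |p.1 i| ≤ ‖p.1‖ := norm_le_pi_norm p.1 i
  have h2 : |p.2 j| ≤ ‖p.2‖ := norm_le_pi_norm p.2 j
  rw [abs_mul]
  have : |p.1 i| * |p.2 j| ≤ ‖p.1‖ * ‖p.2‖ := by gcongr
  nlinarith [sq_nonneg (‖p.1‖ - ‖p.2‖), sq_nonneg (‖p.1‖ + ‖p.2‖)]

theorem integ_fst (hP : Integrable (fun x => ‖x‖ ^ 2) P) (hQ : Integrable (fun y => ‖y‖ ^ 2) Q)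
    {π : Measure ((Fin I → ℝ) × (Fin J → ℝ))} (hπ : π ∈ couplings P Q) (i : Fin I) :
    Integrable (fun p => p.1 i) π := by
  refine (integ_aux hP hQ hπ _ (by fun_prop) fun p => ?_).1
  have h1 : |p.1 i| ≤ ‖p.1‖ := norm_le_pi_norm p.1 i
  nlinarith [sq_nonneg (‖p.1‖ - 1), sq_nonneg ‖p.2‖, sq_nonneg ‖p.1‖]

theorem integ_snd (hP : Integrable (fun x => ‖x‖ ^ 2) P) (hQ : Integrable (fun y => ‖y‖ ^ 2) Q)
    {π : Measure ((Fin I → ℝ) × (Fin J → ℝ))} (hπ : π ∈ couplings P Q) (i : Fin J) :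
    Integrable (fun p => p.2 i) π := by
  refine (integ_aux hP hQ hπ _ (by fun_prop) fun p => ?_).1
  have h1 : |p.2 i| ≤ ‖p.2‖ := norm_le_pi_norm p.2 i
  nlinarith [sq_nonneg (‖p.2‖ - 1), sq_nonneg ‖p.2‖, sq_nonneg ‖p.1‖]

theorem integ_cost (hP : Integrable (fun x => ‖x‖ ^ 2) P) (hQ : Integrable (fun y => ‖y‖ ^ 2) Q)
    {π : Measure ((Fin I → ℝ) × (Fin J → ℝ))} (hπ : π ∈ couplings P Q)
    (M : Matrix (Fin I) (Fin J) ℝ) :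
    Integrable (fun p => M.mulVec p.2 ⬝ᵥ p.1) π ∧
      (M.transpose * crossCov π).trace = ∫ p, M.mulVec p.2 ⬝ᵥ p.1 ∂π := by
  have e : (fun p : (Fin I → ℝ) × (Fin J → ℝ) => M.mulVec p.2 ⬝ᵥ p.1) =
      fun p => ∑ i, ∑ j, M i j * (p.1 i * p.2 j) := by
    funext p
    simp only [dotProduct, mulVec, Finset.sum_mul]
    refine Finset.sum_congr rfl fun i _ => Finset.sum_congr rfl fun j _ => by ring
  have ij : ∀ i j, Integrable (fun p : (Fin I → ℝ) × (Fin J → ℝ) => M i j * (p.1 i * p.2 j)) π :=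
    fun i j => (integ_mul hP hQ hπ i j).1.const_mul _
  rw [e]
  refine ⟨integrable_finsetSum _ fun i _ => integrable_finsetSum _ fun j _ => ij i j, ?_⟩
  rw [integral_finsetSum _ fun i _ => integrable_finsetSum _ fun j _ => ij i j]
  simp only [integral_finsetSum _ fun j _ => ij _ j, integral_const_mul]
  simp only [trace, diag, mul_apply, transpose_apply, crossCov, of_apply]
  exact Finset.sum_comm

theorem bdd_cost (hP : Integrable (fun x => ‖x‖ ^ 2) P) (hQ : Integrable (fun y => ‖y‖ ^ 2) Q)
    (M : Matrix (Fin I) (Fin J) ℝ) :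
    BddAbove ((fun π' => (M.transpose * crossCov π').trace) '' couplings P Q) := by
  refine ⟨∑ j, ∑ i, |M i j| * (1 + ∫ x, ‖x‖ ^ 2 ∂P + ∫ y, ‖y‖ ^ 2 ∂Q), ?_⟩
  rintro _ ⟨π, hπ, rfl⟩
  simp only [trace, diag, mul_apply, transpose_apply, crossCov, of_apply]
  refine Finset.sum_le_sum fun j _ => Finset.sum_le_sum fun i _ => ?_
  refine (le_abs_self _).trans ?_
  rw [abs_mul]
  gcongr
  exact (integ_mul hP hQ hπ i j).2

theorem opt_of_sub (hP : Integrable (fun x => ‖x‖ ^ 2) P) (hQ : Integrable (fun y => ‖y‖ ^ 2) Q)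
    {π π' : Measure ((Fin I → ℝ) × (Fin J → ℝ))} (hπ : π ∈ couplings P Q)
    (hπ' : π' ∈ couplings P Q)
    (M : Matrix (Fin I) (Fin J) ℝ) (u : (Fin I → ℝ) → EReal)
    (h1 : ∃ x, u x ≠ ⊤) (h2 : ∀ x, u x ≠ ⊥) (h3 : LowerSemicontinuous u)
    (h4 : ∀ᵐ p ∂π, ∀ z : Fin I → ℝ,
            u p.1 + ((M.mulVec p.2 ⬝ᵥ (z - p.1) : ℝ) : EReal) ≤ u z) :
    ∫ p, M.mulVec p.2 ⬝ᵥ p.1 ∂π' ≤ ∫ p, M.mulVec p.2 ⬝ᵥ p.1 ∂π := by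
  obtain ⟨x0, hx0⟩ := h1
  set f : (Fin I → ℝ) → ℝ := fun x => (u x).toReal with hf
  have hfu : ∀ x, u x ≠ ⊤ → u x = (f x : EReal) := fun x hx => (EReal.coe_toReal hx (h2 x)).symm
  set v : (Fin J → ℝ) → EReal := fun y =>
    ⨆ z : {z // u z ≠ ⊤}, ((M.mulVec y ⬝ᵥ z.1 - f z.1 : ℝ) : EReal) with hv
  set g : (Fin J → ℝ) → ℝ := fun y => (v y).toReal with hg
  have hvl : ∀ y z, u z ≠ ⊤ → ((M.mulVec y ⬝ᵥ z - f z : ℝ) : EReal) ≤ v y := fun y z hz =>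
    le_iSup (fun z : {z // u z ≠ ⊤} => ((M.mulVec y ⬝ᵥ z.1 - f z.1 : ℝ) : EReal)) ⟨z, hz⟩
  have hvb : ∀ y, v y ≠ ⊥ := fun y h => by
    have := hvl y x0 hx0
    rw [h] at this
    exact EReal.coe_ne_bot _ (le_bot_iff.1 this)
  have hvu : ∀ y, v y ≠ ⊤ → v y = (g y : EReal) := fun y hy => (EReal.coe_toReal hy (hvb y)).symm
  have hum : Measurable u := h3.measurable
  have hvm : Measurable v := by
    refine LowerSemicontinuous.measurable (lowerSemicontinuous_iSup fun z => ?_)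
    refine (continuous_coe_real_ereal.comp ?_).lowerSemicontinuous
    simp only [dotProduct, mulVec]
    fun_prop
  have hfm : Measurable f := hum.ereal_toReal
  have hgm : Measurable g := hvm.ereal_toReal
  -- pointwise consequences
  have ae1 : ∀ᵐ p ∂π, u p.1 ≠ ⊤ ∧ v p.2 ≠ ⊤ ∧ f p.1 + g p.2 = M.mulVec p.2 ⬝ᵥ p.1 := by
    filter_upwards [h4] with p hp
    have hut : u p.1 ≠ ⊤ := by
      intro h
      have := hp x0
      rw [h, EReal.top_add_coe] at this
      exact hx0 (top_le_iff.1 this)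
    have hve : v p.2 = ((M.mulVec p.2 ⬝ᵥ p.1 - f p.1 : ℝ) : EReal) := by
      refine le_antisymm (iSup_le fun z => ?_) (hvl _ _ hut)
      have := hp z.1
      rw [hfu _ hut, hfu _ z.2, ← EReal.coe_add, EReal.coe_le_coe_iff, dotProduct_sub] at this
      rw [EReal.coe_le_coe_iff]
      linarith
    refine ⟨hut, ?_, ?_⟩
    · rw [hve]; exact EReal.coe_ne_top _
    · simp only [hg]
      rw [hve, EReal.toReal_coe]
      ring
  have mu : MeasurableSet {x | u x ≠ ⊤} := (hum (measurableSet_singleton ⊤)).compl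
  have mv : MeasurableSet {x | v x ≠ ⊤} := (hvm (measurableSet_singleton ⊤)).compl
  have aeP : ∀ᵐ x ∂P, u x ≠ ⊤ := by
    rw [← hπ.2.1]
    refine (ae_map_iff measurable_fst.aemeasurable mu).2 (ae1.mono fun p h => h.1)
  have aeQ : ∀ᵐ x ∂Q, v x ≠ ⊤ := by
    rw [← hπ.2.2]
    refine (ae_map_iff measurable_snd.aemeasurable mv).2 (ae1.mono fun p h => h.2.1)
  have ae2 : ∀ᵐ p ∂π', M.mulVec p.2 ⬝ᵥ p.1 ≤ f p.1 + g p.2 := by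
    have a := (ae_map_iff measurable_fst.aemeasurable mu).1 (hπ'.2.1.symm ▸ aeP)
    have b := (ae_map_iff measurable_snd.aemeasurable mv).1 (hπ'.2.2.symm ▸ aeQ)
    filter_upwards [a, b] with p hp1 hp2
    have := hvl p.2 p.1 hp1
    rw [hvu _ hp2, EReal.coe_le_coe_iff] at this
    linarith
  -- integrability
  have := hπ.1
  have := hπ'.1
  obtain ⟨p1, hp1, hp1', -⟩ := (h4.and ae1).exists
  have Ic := (integ_cost hP hQ hπ M).1
  have Ic' := (integ_cost hP hQ hπ' M).1
  have Ia : Integrable (fun p : (Fin I → ℝ) × (Fin J → ℝ) =>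
      f p1.1 + M.mulVec p1.2 ⬝ᵥ (p.1 - p1.1)) π := by
    simp only [dotProduct_sub]
    refine (integrable_const _).add (Integrable.sub ?_ (integrable_const _))
    simp only [dotProduct]
    exact integrable_finsetSum _ fun i _ => (integ_fst hP hQ hπ i).const_mul _
  have Ib : Integrable (fun p : (Fin I → ℝ) × (Fin J → ℝ) => M.mulVec p.2 ⬝ᵥ x0 - f x0) π := by
    refine Integrable.sub ?_ (integrable_const _)
    simp only [dotProduct, mulVec]
    exact integrable_finsetSum _ fun i _ => (integrable_finsetSum _ fun j _ =>
      (integ_snd hP hQ hπ j).const_mul _).mul_const _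
  have If : Integrable (fun p : (Fin I → ℝ) × (Fin J → ℝ) => f p.1) π := by
    refine (Ia.abs.add (Ic.sub Ib).abs).mono' (hfm.comp measurable_fst).aestronglyMeasurable ?_
    filter_upwards [ae1] with p ⟨q1, q2, q3⟩
    have b1 := hp1 p.1
    rw [hfu _ hp1', hfu _ q1, ← EReal.coe_add, EReal.coe_le_coe_iff] at b1
    have b2 := hvl p.2 x0 hx0
    rw [hvu _ q2, EReal.coe_le_coe_iff] at b2
    simp only [Pi.add_apply, Pi.sub_apply, Real.norm_eq_abs]
    refine abs_le.2 ⟨?_, ?_⟩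
    · have := neg_abs_le (f p1.1 + M.mulVec p1.2 ⬝ᵥ (p.1 - p1.1))
      have := abs_nonneg (M.mulVec p.2 ⬝ᵥ p.1 - (M.mulVec p.2 ⬝ᵥ x0 - f x0))
      linarith
    · have := abs_nonneg (f p1.1 + M.mulVec p1.2 ⬝ᵥ (p.1 - p1.1))
      have := le_abs_self (M.mulVec p.2 ⬝ᵥ p.1 - (M.mulVec p.2 ⬝ᵥ x0 - f x0))
      linarith
  have Ig : Integrable (fun p : (Fin I → ℝ) × (Fin J → ℝ) => g p.2) π := by
    refine (Ic.sub If).congr ?_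
    filter_upwards [ae1] with p ⟨q1, q2, q3⟩
    simp only [Pi.sub_apply]
    linarith
  have IfP : Integrable f P := by
    rw [← hπ.2.1]
    exact (integrable_map_measure hfm.aestronglyMeasurable measurable_fst.aemeasurable).2 If
  have IgQ : Integrable g Q := by
    rw [← hπ.2.2]
    exact (integrable_map_measure hgm.aestronglyMeasurable measurable_snd.aemeasurable).2 Ig
  have If' : Integrable (fun p : (Fin I → ℝ) × (Fin J → ℝ) => f p.1) π' := by
    rw [← hπ'.2.1] at IfP
    exact IfP.comp_measurable measurable_fst
  have Ig' : Integrable (fun p : (Fin I → ℝ) × (Fin J → ℝ) => g p.2) π' := by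
    rw [← hπ'.2.2] at IgQ
    exact IgQ.comp_measurable measurable_snd
  have eP : ∀ ρ ∈ couplings P Q, ∫ p, f p.1 ∂ρ = ∫ x, f x ∂P := by
    rintro ρ ⟨-, r1, -⟩
    rw [← r1, integral_map measurable_fst.aemeasurable hfm.aestronglyMeasurable]
  have eQ : ∀ ρ ∈ couplings P Q, ∫ p, g p.2 ∂ρ = ∫ x, g x ∂Q := by
    rintro ρ ⟨-, -, r1⟩
    rw [← r1, integral_map measurable_snd.aemeasurable hgm.aestronglyMeasurable]
  calc ∫ p, M.mulVec p.2 ⬝ᵥ p.1 ∂π' ≤ ∫ p, (f p.1 + g p.2) ∂π' :=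
        integral_mono_ae Ic' (If'.add Ig') ae2
    _ = ∫ p, (f p.1 + g p.2) ∂π := by
        rw [integral_add If' Ig', integral_add If Ig, eP _ hπ, eP _ hπ', eQ _ hπ, eQ _ hπ']
    _ = _ := integral_congr_ae (ae1.mono fun p h => h.2.2)

end integ

/-- for a compact basis `B`, `π ∈ Π(P,Q)` and `M ∈ B`, the coupling
maximizes `Tr(Mᵀ σ_π)` over `Π(P,Q)` iff there is a proper lsc convex
`u : ℝ^I → ℝ ∪ {+∞}` with `My ∈ ∂u(x)` `π`-almost surely. -/
theorem maxCorrelation_iff_subdifferential_basis {I J : ℕ} (hI : 0 < I) (hJ : 0 < J)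
    (P : Measure (Fin I → ℝ)) (Q : Measure (Fin J → ℝ))
    [IsProbabilityMeasure P] [IsProbabilityMeasure Q]
    (hP : Integrable (fun x => ‖x‖ ^ 2) P) (hQ : Integrable (fun y => ‖y‖ ^ 2) Q)
    (B : Set (Matrix (Fin I) (Fin J) ℝ))
    (hBcompact : IsCompact B) (hBconvex : Convex ℝ B) (hB0 : (0 : Matrix (Fin I) (Fin J) ℝ) ∉ B)
    (π : Measure ((Fin I → ℝ) × (Fin J → ℝ))) (hπ : π ∈ couplings P Q)
    (M : Matrix (Fin I) (Fin J) ℝ) (hM : M ∈ B) :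
    ((M.transpose * crossCov π).trace =
        sSup ((fun π' => (M.transpose * crossCov π').trace) '' couplings P Q)) ↔
      ∃ u : (Fin I → ℝ) → EReal,
        (∃ x, u x ≠ ⊤) ∧ (∀ x, u x ≠ ⊥) ∧ LowerSemicontinuous u ∧ ERealConvexOn u ∧
          ∀ᵐ p ∂π, ∀ z : Fin I → ℝ,
            u p.1 + ((M.mulVec p.2 ⬝ᵥ (z - p.1) : ℝ) : EReal) ≤ u z := by
  constructor
  · intro hopt
    have hprob := hπ.1
    have hle : ∀ π' ∈ couplings P Q,
        ∫ p, M.mulVec p.2 ⬝ᵥ p.1 ∂π' ≤ ∫ p, M.mulVec p.2 ⬝ᵥ p.1 ∂π := by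
      intro π' hπ'
      rw [← (integ_cost hP hQ hπ M).2, ← (integ_cost hP hQ hπ' M).2, hopt]
      exact le_csSup (bdd_cost hP hQ M) ⟨π', hπ', rfl⟩
    obtain ⟨u, u1, u2, u3, u4, u5⟩ := rockafellar M π.support
      (Measure.nonempty_support (IsProbabilityMeasure.ne_zero π)) (by
        intro n p hp
        by_contra! hlt
        obtain ⟨π', a0, a1, a2, a3⟩ := swap_improves π (fun p => M.mulVec p.2 ⬝ᵥ p.1)
          (by simp only [dotProduct, mulVec]; fun_prop)
          (fun π' b0 b1 b2 => (integ_cost hP hQ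
            ⟨b0, b1.trans hπ.2.1, b2.trans hπ.2.2⟩ M).1) (finRotate (n + 1)) p hp hlt
        exact absurd (hle π' ⟨a0, a1.trans hπ.2.1, a2.trans hπ.2.2⟩) (not_le.2 a3))
    refine ⟨u, u1, u2, u3, u4, ?_⟩
    filter_upwards [Measure.support_mem_ae (μ := π)] with p hp
    exact u5 p hp
  · rintro ⟨u, u1, u2, u3, -, u5⟩
    have hg : IsGreatest ((fun π' => (M.transpose * crossCov π').trace) '' couplings P Q)
        (M.transpose * crossCov π).trace := by
      refine ⟨⟨π, hπ, rfl⟩, ?_⟩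
      rintro _ ⟨π', hπ', rfl⟩
      simp only
      rw [(integ_cost hP hQ hπ M).2, (integ_cost hP hQ hπ' M).2]
      exact opt_of_sub hP hQ hπ hπ' M u u1 u2 u3 u5
    exact hg.csSup_eq.symm
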